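/- For every δ,θ>0 there exist Δ₀=Δ₀(δ,θ) and C>0 such that for every finite graph G=(V,E) with maximum degree Δ≥Δ₀ and girth at least 6, every 0<λ<(1−δ)·λ_c(Δ), and every z∈V: if X is distributed according to the hard-core Gibbs distribution μ, then P( |R(X,z) − ω*(z)| ≤ θ ) ≥ 1 − exp(−Δ/C), where ω* is the unique fixed point of the belief-propagation operator F. -/

import Mathlib

open scoped BigOperators

attribute [local instance] Classical.propDecidable

noncomputable section

namespace HardCore

/-- The critical fugacity `λ_c(Δ) = (Δ-1)^(Δ-1) / (Δ-2)^Δ`. -/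
def lambdaC (D : ℕ) : ℝ := ((D : ℝ) - 1) ^ (D - 1) / ((D : ℝ) - 2) ^ D

variable {V : Type} [Fintype V] [DecidableEq V]

/-- `s` is an independent set of `G`. -/
def IsIndep (G : SimpleGraph V) (s : Finset V) : Prop :=
  ∀ u ∈ s, ∀ w ∈ s, ¬ G.Adj u w

/-- hard-core weight `λ^|σ|` of an independent set (0 for non-independent sets). -/
def weight (G : SimpleGraph V) (lam : ℝ) (s : Finset V) : ℝ :=
  if IsIndep G s then lam ^ s.card else 0

/-- The hard-core Gibbs distribution `μ(σ) = λ^|σ| / Z`. -/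
def gibbs (G : SimpleGraph V) (lam : ℝ) (s : Finset V) : ℝ :=
  weight G lam s / ∑ t : Finset V, weight G lam t

/-- Probability of an event under the Gibbs distribution. -/
def gibbsProb (G : SimpleGraph V) (lam : ℝ) (A : Set (Finset V)) : ℝ :=
  ∑ s : Finset V, if s ∈ A then gibbs G lam s else 0

/-- `U_{v,p}(σ)`: indicator that `σ ∩ (N(v) \ {p}) = ∅`. -/
def unblockedInd (G : SimpleGraph V) [DecidableRel G.Adj] (σ : Finset V) (v p : V) : ℝ :=
  if σ ∩ ((G.neighborFinset v).erase p) = ∅ then 1 else 0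

/-- `R(σ,v) = ∏_{z ∈ N(v)} (1 - (λ/(1+λ))·U_{z,v}(σ))`. -/
def Rfun (G : SimpleGraph V) [DecidableRel G.Adj] (lam : ℝ) (σ : Finset V) (v : V) : ℝ :=
  ∏ z ∈ G.neighborFinset v, (1 - lam / (1 + lam) * unblockedInd G σ z v)

/-- The belief-propagation operator `F(ω)(v) = ∏_{u ∈ N(v)} 1/(1 + λ·ω(u))`. -/
def bpF (G : SimpleGraph V) [DecidableRel G.Adj] (lam : ℝ) (ω : V → ℝ) : V → ℝ :=
  fun v => ∏ u ∈ G.neighborFinset v, (1 + lam * ω u)⁻¹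

end HardCore

open HardCore

namespace HardCore

set_option linter.unusedSectionVars false

section Resampling

variable {V : Type} [Fintype V] [DecidableEq V]

/-- The unnormalised Gibbs expectation of `f`. -/
def gibbsSum (G : SimpleGraph V) (lam : ℝ) (f : Finset V → ℝ) : ℝ :=
  ∑ σ : Finset V, weight G lam σ * f σ

/-- `f` does not depend on the occupation of `w`. -/
def FreeAt (f : Finset V → ℝ) (w : V) : Prop := ∀ σ, f (insert w σ) = f σ

/-- Indicator that `z` is unoccupied. -/
def vacant (z : V) (σ : Finset V) : ℝ := if z ∈ σ then 0 else 1

/-- The product defining `Rfun G lam σ z`, without the factor of the neighbour `v`. -/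
def Rerase (G : SimpleGraph V) [DecidableRel G.Adj] (lam : ℝ) (v z : V) (σ : Finset V) : ℝ :=
  ∏ w ∈ (G.neighborFinset z).erase v, (1 - lam / (1 + lam) * unblockedInd G σ w z)

lemma FreeAt.mul {f g : Finset V → ℝ} {w : V} (hf : FreeAt f w) (hg : FreeAt g w) :
    FreeAt (fun σ => f σ * g σ) w := fun σ => by simp only [hf σ, hg σ]

lemma FreeAt.prod {ι : Type*} {s : Finset ι} {f : ι → Finset V → ℝ} {w : V}
    (hf : ∀ i ∈ s, FreeAt (f i) w) : FreeAt (fun σ => ∏ i ∈ s, f i σ) w :=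
  fun σ => Finset.prod_congr rfl fun i hi => hf i hi σ

lemma FreeAt.comp {f : Finset V → ℝ} {w : V} (hf : FreeAt f w) (g : ℝ → ℝ) :
    FreeAt (fun σ => g (f σ)) w := fun σ => by simp only [hf σ]

lemma freeAt_vacant {z w : V} (h : w ≠ z) : FreeAt (vacant z) w := fun σ => by
  simp [vacant, Finset.mem_insert, h.symm]

section Unblocked

variable (G : SimpleGraph V) [DecidableRel G.Adj]

lemma freeAt_unblockedInd {v p w : V} (h : w = p ∨ ¬ G.Adj v w) :
    FreeAt (fun σ => unblockedInd G σ v p) w := fun σ => by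
  have : w ∉ (G.neighborFinset v).erase p := by
    rcases h with rfl | h
    · simp
    · simp [h]
  simp only [unblockedInd, Finset.insert_inter_of_notMem this]

lemma unblockedInd_mem (σ : Finset V) (v p : V) : unblockedInd G σ v p ∈ Set.Icc (0 : ℝ) 1 := by
  unfold unblockedInd; split_ifs <;> simp

lemma unblockedInd_eq_prod_vacant (σ : Finset V) (v p : V) :
    unblockedInd G σ v p = ∏ w ∈ (G.neighborFinset v).erase p, vacant w σ := by
  unfold unblockedInd
  split_ifs with h
  · refine (Finset.prod_eq_one fun w hw => ?_).symm
    have : w ∉ σ := fun hσ => by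
      have : w ∈ σ ∩ (G.neighborFinset v).erase p := Finset.mem_inter.2 ⟨hσ, hw⟩
      simp [h] at this
    simp [vacant, this]
  · obtain ⟨w, hw⟩ := Finset.nonempty_iff_ne_empty.2 h
    rw [Finset.mem_inter] at hw
    exact (Finset.prod_eq_zero hw.2 (by simp [vacant, hw.1])).symm

lemma factor_mem {lam : ℝ} (hlam : 0 < lam) (σ : Finset V) (v p : V) :
    1 - lam / (1 + lam) * unblockedInd G σ v p ∈ Set.Icc (0 : ℝ) 1 := by
  have h := unblockedInd_mem G σ v p
  have h1 : lam / (1 + lam) ≤ 1 := by rw [div_le_one (by linarith)]; linarith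
  have h0 : 0 ≤ lam / (1 + lam) := by positivity
  constructor
  · nlinarith [h.1, h.2]
  · nlinarith [h.1, h.2]

lemma Rerase_mem {lam : ℝ} (hlam : 0 < lam) (v z : V) (σ : Finset V) :
    Rerase G lam v z σ ∈ Set.Icc (0 : ℝ) 1 :=
  ⟨Finset.prod_nonneg fun w _ => (factor_mem G hlam σ w z).1,
    Finset.prod_le_one (fun w _ => (factor_mem G hlam σ w z).1)
      fun w _ => (factor_mem G hlam σ w z).2⟩

lemma abs_Rfun_sub_Rerase_le {lam : ℝ} (hlam : 0 < lam) {v z : V} (h : G.Adj v z)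
    (σ : Finset V) : |Rfun G lam σ z - Rerase G lam v z σ| ≤ lam := by
  have hv : v ∈ G.neighborFinset z := by simpa using h.symm
  have h1 := Rerase_mem G hlam v z σ
  have hU := unblockedInd_mem G σ v z
  have hc : lam / (1 + lam) ≤ lam := div_le_self hlam.le (by linarith)
  have h0 : 0 ≤ lam / (1 + lam) := by positivity
  have hR : Rfun G lam σ z =
      (1 - lam / (1 + lam) * unblockedInd G σ v z) * Rerase G lam v z σ :=
    (Finset.mul_prod_erase _ _ hv).symm
  have hcU : lam / (1 + lam) * unblockedInd G σ v z ≤ lam / (1 + lam) :=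
    mul_le_of_le_one_right h0 hU.2
  have hcU0 : 0 ≤ lam / (1 + lam) * unblockedInd G σ v z := mul_nonneg h0 hU.1
  rw [hR, abs_le]
  constructor <;> nlinarith [h1.1, h1.2]

end Unblocked

section Gibbs

variable (G : SimpleGraph V) {lam : ℝ}

lemma weight_nonneg (hlam : 0 < lam) (σ : Finset V) : 0 ≤ weight G lam σ := by
  unfold weight; split_ifs <;> positivity

lemma weight_insert {w : V} {σ : Finset V} (hw : w ∉ σ) :
    weight G lam (insert w σ) =
      if ∀ u ∈ σ, ¬ G.Adj w u then lam * weight G lam σ else 0 := by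
  have key : IsIndep G (insert w σ) ↔ (∀ u ∈ σ, ¬ G.Adj w u) ∧ IsIndep G σ := by
    constructor
    · intro h
      exact ⟨fun u hu => h w (by simp) u (by simp [hu]),
        fun a ha b hb => h a (by simp [ha]) b (by simp [hb])⟩
    · rintro ⟨h1, h2⟩ a ha b hb hab
      rw [Finset.mem_insert] at ha hb
      rcases ha with rfl | ha <;> rcases hb with rfl | hb
      · exact G.loopless.irrefl _ hab
      · exact h1 b hb hab
      · exact h1 a ha hab.symm
      · exact h2 a ha b hb hab
  unfold weight
  rw [Finset.card_insert_of_notMem hw]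
  by_cases h1 : ∀ u ∈ σ, ¬ G.Adj w u <;> by_cases h2 : IsIndep G σ <;>
    simp [key, h1, h2, pow_succ, mul_comm]

lemma sum_eq_sum_add_insert (w : V) (φ : Finset V → ℝ) :
    ∑ σ : Finset V, φ σ = ∑ σ : Finset V with w ∉ σ, (φ σ + φ (insert w σ)) := by
  rw [Finset.sum_add_distrib, ← Finset.sum_filter_add_sum_filter_not Finset.univ (w ∉ ·)]
  congr 1
  refine Finset.sum_nbij' (fun σ => σ.erase w) (fun σ => insert w σ) ?_ ?_ ?_ ?_ ?_
  · simp
  · simp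
  · intro σ hσ; exact Finset.insert_erase (by simpa using hσ)
  · intro σ hσ; exact Finset.erase_insert (by simpa using hσ)
  · intro σ hσ; rw [Finset.insert_erase (by simpa using hσ)]

lemma gibbsSum_mono (hlam : 0 < lam) {f g : Finset V → ℝ} (h : ∀ σ, f σ ≤ g σ) :
    gibbsSum G lam f ≤ gibbsSum G lam g :=
  Finset.sum_le_sum fun σ _ => mul_le_mul_of_nonneg_left (h σ) (weight_nonneg G hlam σ)

lemma gibbsSum_add (f g : Finset V → ℝ) :
    gibbsSum G lam (fun σ => f σ + g σ) = gibbsSum G lam f + gibbsSum G lam g := by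
  simp only [gibbsSum, mul_add, Finset.sum_add_distrib]

lemma gibbsSum_const_mul (c : ℝ) (f : Finset V → ℝ) :
    gibbsSum G lam (fun σ => c * f σ) = c * gibbsSum G lam f := by
  simp only [gibbsSum, Finset.mul_sum]
  exact Finset.sum_congr rfl fun σ _ => by ring

lemma gibbsSum_one_pos (hlam : 0 < lam) : 0 < gibbsSum G lam (fun _ => 1) := by
  refine Finset.sum_pos' (fun σ _ => mul_nonneg (weight_nonneg G hlam σ) zero_le_one)
    ⟨∅, Finset.mem_univ _, ?_⟩
  simp [weight, IsIndep]

lemma gibbsSum_occupied_le (hlam : 0 < lam) {z : V} {K : Finset V → ℝ} (hK : ∀ σ, 0 ≤ K σ)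
    (hKz : FreeAt K z) :
    gibbsSum G lam (fun σ => K σ * (1 - vacant z σ)) ≤ lam * gibbsSum G lam K := by
  rw [gibbsSum, gibbsSum, sum_eq_sum_add_insert z, sum_eq_sum_add_insert z, Finset.mul_sum]
  refine Finset.sum_le_sum fun σ hσ => ?_
  have hσ' : z ∉ σ := by simpa using hσ
  have hw := weight_nonneg G hlam σ
  have := hK σ
  have h0 : 0 ≤ weight G lam σ * K σ := by positivity
  rw [weight_insert G hσ', hKz σ]
  simp only [vacant, hσ', Finset.mem_insert_self, if_true, if_false]
  split_ifs <;> nlinarith [mul_nonneg hlam.le h0, mul_nonneg hlam.le (mul_nonneg hlam.le h0)]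

variable [DecidableRel G.Adj]

/-- Resampling the single vertex `w`, conditionally on its neighbour `z` being unoccupied. -/
lemma gibbsSum_vacant_eq (hlam : 0 < lam) {z w : V} (hzw : G.Adj z w) {M : Finset V → ℝ}
    (hM : FreeAt M w) :
    gibbsSum G lam (fun σ => M σ * vacant z σ * vacant w σ) =
      gibbsSum G lam (fun σ => M σ * vacant z σ *
        (1 - lam / (1 + lam) * unblockedInd G σ w z)) := by
  rw [gibbsSum, gibbsSum, sum_eq_sum_add_insert w, sum_eq_sum_add_insert w]
  refine Finset.sum_congr rfl fun σ hσ => ?_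
  have hσ' : w ∉ σ := by simpa using hσ
  have hU : unblockedInd G (insert w σ) w z = unblockedInd G σ w z :=
    freeAt_unblockedInd G (Or.inr (G.loopless.irrefl w)) σ
  have hv : vacant z (insert w σ) = vacant z σ := freeAt_vacant hzw.ne' σ
  have hw1 : vacant w σ = 1 := by simp [vacant, hσ']
  have hw0 : vacant w (insert w σ) = 0 := by simp [vacant]
  rw [hU, hv, hM σ, hw1, hw0, weight_insert G hσ']
  by_cases hz : z ∈ σ
  · simp [vacant, hz]
  have hiff : σ ∩ (G.neighborFinset w).erase z = ∅ ↔ ∀ u ∈ σ, ¬ G.Adj w u := by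
    rw [Finset.eq_empty_iff_forall_notMem]
    constructor
    · intro h u hu hwu
      refine h u ?_
      simp [hu, hwu]
      rintro rfl
      exact hz hu
    · intro h u hu
      simp at hu
      exact h u hu.1 hu.2.2
  have hlam' : 1 + lam ≠ 0 := by positivity
  unfold unblockedInd
  by_cases h : ∀ u ∈ σ, ¬ G.Adj w u
  · rw [if_pos h, if_pos (hiff.2 h)]
    field_simp
    ring
  · rw [if_neg h, if_neg (mt hiff.1 h)]
    ring

lemma gibbsSum_prod_vacant_eq (hlam : 0 < lam) {z : V} (A : Finset V)
    (hA : ∀ w ∈ A, G.Adj z w) (htri : ∀ w ∈ A, ∀ w' ∈ A, ¬ G.Adj w w') :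
    ∀ {K : Finset V → ℝ}, (∀ w ∈ A, FreeAt K w) →
    gibbsSum G lam (fun σ => K σ * vacant z σ * ∏ w ∈ A, vacant w σ) =
      gibbsSum G lam (fun σ => K σ * vacant z σ *
        ∏ w ∈ A, (1 - lam / (1 + lam) * unblockedInd G σ w z)) := by
  induction A using Finset.induction_on with
  | empty => intros; rfl
  | insert w A hw ih =>
    intro K hK
    simp only [Finset.prod_insert hw]
    have h1 := ih (fun a ha => hA a (by simp [ha]))
      (fun a ha b hb => htri a (by simp [ha]) b (by simp [hb]))
      (K := fun σ => K σ * vacant w σ)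
      (fun a ha => (hK a (by simp [ha])).mul (freeAt_vacant (by rintro rfl; exact hw ha)))
    have h2 := gibbsSum_vacant_eq G hlam (hA w (by simp))
      (M := fun σ => K σ * ∏ a ∈ A, (1 - lam / (1 + lam) * unblockedInd G σ a z))
      ((hK w (by simp)).mul (FreeAt.prod fun a ha =>
        (freeAt_unblockedInd G (Or.inr (htri a (by simp [ha]) w (by simp)))).comp
          (fun x => 1 - lam / (1 + lam) * x)))
    calc _ = _ := ?_
      _ = _ := h1
      _ = _ := ?_
      _ = _ := h2
      _ = _ := ?_
    all_goals congr 1; funext σ; ring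

/-- Given the spins away from `z` and its other neighbours, `unblockedInd G σ z v` has
conditional mean within `lam` of `Rerase G lam v z σ`. -/
lemma abs_gibbsSum_unblockedInd_sub_le (hlam : 0 < lam) {v z : V}
    (htri : ∀ w w', G.Adj z w → G.Adj z w' → ¬ G.Adj w w') {K : Finset V → ℝ}
    (hK0 : ∀ σ, 0 ≤ K σ) (hKz : FreeAt K z) (hK : ∀ w, G.Adj z w → w ≠ v → FreeAt K w) :
    |gibbsSum G lam (fun σ => K σ * (unblockedInd G σ z v - Rerase G lam v z σ))| ≤
      lam * gibbsSum G lam K := by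
  have h1 := gibbsSum_prod_vacant_eq G hlam (z := z) ((G.neighborFinset z).erase v)
    (fun w hw => by simp at hw; exact hw.2)
    (fun w hw w' hw' => by simp at hw hw'; exact htri _ _ hw.2 hw'.2)
    (K := K) (fun w hw => by simp at hw; exact hK w hw.2 hw.1)
  have hocc := gibbsSum_occupied_le G hlam hK0 hKz
  have hsplit : gibbsSum G lam (fun σ => K σ * (unblockedInd G σ z v - Rerase G lam v z σ)) =
      gibbsSum G lam (fun σ => K σ * (1 - vacant z σ) *
        (unblockedInd G σ z v - Rerase G lam v z σ)) := by
    have e1 : gibbsSum G lam (fun σ => K σ * (unblockedInd G σ z v - Rerase G lam v z σ)) =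
      gibbsSum G lam (fun σ => K σ * (1 - vacant z σ) *
        (unblockedInd G σ z v - Rerase G lam v z σ)) +
      (gibbsSum G lam (fun σ => K σ * vacant z σ *
          ∏ w ∈ (G.neighborFinset z).erase v, vacant w σ) +
        (-1) * gibbsSum G lam (fun σ => K σ * vacant z σ * Rerase G lam v z σ)) := by
      rw [← gibbsSum_const_mul, ← gibbsSum_add, ← gibbsSum_add]
      congr 1; funext σ
      rw [← unblockedInd_eq_prod_vacant]; ring
    rw [e1, h1]
    unfold Rerase
    ring
  have hbd : ∀ σ, |K σ * (1 - vacant z σ) * (unblockedInd G σ z v - Rerase G lam v z σ)| ≤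
      K σ * (1 - vacant z σ) := fun σ => by
    have h2 : 0 ≤ 1 - vacant z σ := by unfold vacant; split_ifs <;> simp
    have h3 : 0 ≤ K σ * (1 - vacant z σ) := mul_nonneg (hK0 σ) h2
    rw [abs_mul, abs_of_nonneg h3]
    refine mul_le_of_le_one_right h3 ?_
    have hU := unblockedInd_mem G σ z v
    have hR := Rerase_mem G hlam v z σ
    rw [abs_le]; constructor <;> linarith [hU.1, hU.2, hR.1, hR.2]
  rw [hsplit]
  refine le_trans ?_ hocc
  rw [abs_le]
  constructor
  · have := gibbsSum_mono G hlam (fun σ => neg_le_of_abs_le (hbd σ))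
    have e := gibbsSum_const_mul G (lam := lam) (-1) (fun σ => K σ * (1 - vacant z σ))
    simp only [neg_one_mul] at e
    linarith
  · exact gibbsSum_mono G hlam (fun σ => le_of_abs_le (hbd σ))

end Gibbs

end Resampling

section Girth

variable {V : Type} {G : SimpleGraph V}

lemma not_adj_of_egirth (hg : 6 ≤ G.egirth) {a b c : V} (hab : G.Adj a b) (hac : G.Adj a c) :
    ¬ G.Adj b c := by
  intro hbc
  let p : G.Walk a a := .cons hab (.cons hbc (.cons hac.symm .nil))
  have hp : p.IsCycle := by
    simp [p, SimpleGraph.Walk.cons_isCycle_iff, SimpleGraph.Walk.isPath_def, hab.ne, hab.ne', hac.ne,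
      hac.ne', hbc.ne]
  have h := hg.trans (SimpleGraph.egirth_le_length hp)
  simp [p] at h
  norm_cast at h

lemma eq_of_adj_of_egirth (hg : 6 ≤ G.egirth) {v z z' w : V} (hvz : G.Adj v z)
    (hvz' : G.Adj v z') (hz : z ≠ z') (hzw : G.Adj z w) (hzw' : G.Adj z' w) : w = v := by
  by_contra hne
  let p : G.Walk v v := .cons hvz (.cons hzw (.cons hzw'.symm (.cons hvz'.symm .nil)))
  have hp : p.IsCycle := by
    simp [p, SimpleGraph.Walk.cons_isCycle_iff, SimpleGraph.Walk.isPath_def, hvz.ne, hvz.ne',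
      hvz'.ne, hvz'.ne', hzw.ne, hzw'.ne', hz, hne, Ne.symm hne]
  have h := hg.trans (SimpleGraph.egirth_le_length hp)
  simp [p] at h
  norm_cast at h

lemma not_adj_of_adj_of_egirth (hg : 6 ≤ G.egirth) {v z z' w w' : V} (hvz : G.Adj v z)
    (hvz' : G.Adj v z') (hz : z ≠ z') (hzw : G.Adj z w) (hzw' : G.Adj z' w') (hw : w ≠ v)
    (hw' : w' ≠ v) : ¬ G.Adj w w' := by
  intro hww
  have h1 : w ≠ z' := by
    rintro rfl
    exact not_adj_of_egirth hg hvz hvz' hzw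
  have h2 : w' ≠ z := by
    rintro rfl
    exact not_adj_of_egirth hg hvz' hvz hzw'
  let p : G.Walk v v :=
    .cons hvz (.cons hzw (.cons hww (.cons hzw'.symm (.cons hvz'.symm .nil))))
  have hp : p.IsCycle := by
    simp [p, SimpleGraph.Walk.cons_isCycle_iff, SimpleGraph.Walk.isPath_def, hvz.ne, hvz.ne',
      hvz'.ne, hvz'.ne', hzw.ne, hzw'.ne', hz, hw, hw.symm,
      hw', hw'.symm, hww.ne, h1, h2.symm]
  have h := hg.trans (SimpleGraph.egirth_le_length hp)
  simp [p] at h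
  norm_cast at h

end Girth

section Contraction

lemma mul_exp_neg_le (x : ℝ) : x * Real.exp (-x) ≤ Real.exp (-1) := by
  have h := Real.add_one_le_exp (x - 1)
  have : Real.exp (-1) = Real.exp (x - 1) * Real.exp (-x) := by
    rw [← Real.exp_add]; ring_nf
  rw [this]
  exact mul_le_mul_of_nonneg_right (by linarith) (Real.exp_pos _).le

lemma mul_sum_abs_mul_exp_le {ι : Type*} (S : Finset ι) (y : ι → ℝ) {lam D κ : ℝ}
    (hlam : 0 < lam) (hκ : 0 ≤ κ) (hS : (S.card : ℝ) ≤ D) (hD : lam * D ≤ κ ^ 2 * Real.exp 1) :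
    lam * (∑ u ∈ S, |y u|) * Real.exp (-(lam / 2) * ∑ u ∈ S, y u ^ 2) ≤ κ := by
  refine le_of_sq_le_sq ?_ hκ
  set Q := ∑ u ∈ S, y u ^ 2 with hQ
  have hQ0 : 0 ≤ Q := Finset.sum_nonneg fun _ _ => sq_nonneg _
  have hcs : (∑ u ∈ S, |y u|) ^ 2 ≤ D * Q := by
    refine sq_sum_le_card_mul_sum_sq.trans ?_
    simp only [sq_abs]
    exact mul_le_mul_of_nonneg_right hS hQ0
  have he : Real.exp (-(lam / 2) * Q) ^ 2 = Real.exp (-(lam * Q)) := by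
    rw [← Real.exp_nat_mul]; congr 1; push_cast; ring
  have hx := mul_exp_neg_le (lam * Q)
  calc (lam * (∑ u ∈ S, |y u|) * Real.exp (-(lam / 2) * Q)) ^ 2
      = lam ^ 2 * (∑ u ∈ S, |y u|) ^ 2 * Real.exp (-(lam * Q)) := by
        rw [mul_pow, mul_pow, he]
    _ ≤ lam ^ 2 * (D * Q) * Real.exp (-(lam * Q)) := by gcongr
    _ = (lam * D) * (lam * Q * Real.exp (-(lam * Q))) := by ring
    _ ≤ (κ ^ 2 * Real.exp 1) * Real.exp (-1) := by gcongr
    _ = κ ^ 2 := by rw [mul_assoc, ← Real.exp_add]; simp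

/-- In the coordinates `y = √ω`, the large-degree limit of belief propagation contracts. -/
lemma abs_exp_neg_sum_sq_sub_le {ι : Type*} (S : Finset ι) (y y' : ι → ℝ) {lam D κ a : ℝ}
    (hlam : 0 < lam) (hκ : 0 ≤ κ) (ha : 0 ≤ a) (hS : (S.card : ℝ) ≤ D)
    (hD : lam * D ≤ κ ^ 2 * Real.exp 1) (hy : ∀ u ∈ S, |y' u - y u| ≤ a) :
    |Real.exp (-(lam / 2) * ∑ u ∈ S, y' u ^ 2) - Real.exp (-(lam / 2) * ∑ u ∈ S, y u ^ 2)| ≤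
      κ * a := by
  let p : ℝ → ι → ℝ := fun t u => y u + t * (y' u - y u)
  let g : ℝ → ℝ := fun t => Real.exp (-(lam / 2) * ∑ u ∈ S, p t u ^ 2)
  have hg : ∀ t, HasDerivAt g (Real.exp (-(lam / 2) * ∑ u ∈ S, p t u ^ 2) *
      (-(lam / 2) * ∑ u ∈ S, 2 * p t u * (y' u - y u))) t := fun t => by
    refine HasDerivAt.exp (HasDerivAt.const_mul _ (HasDerivAt.fun_sum fun u _ => ?_))
    have h1 : HasDerivAt (fun t => p t u) (y' u - y u) t := by
      simpa [p] using ((hasDerivAt_id t).mul_const (y' u - y u)).const_add (y u)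
    simpa using h1.fun_pow 2
  have hbound : ∀ t ∈ Set.Ico (0 : ℝ) 1, ‖Real.exp (-(lam / 2) * ∑ u ∈ S, p t u ^ 2) *
      (-(lam / 2) * ∑ u ∈ S, 2 * p t u * (y' u - y u))‖ ≤ κ * a := fun t _ => by
    have hsum : |∑ u ∈ S, 2 * p t u * (y' u - y u)| ≤ 2 * a * ∑ u ∈ S, |p t u| := by
      refine (Finset.abs_sum_le_sum_abs _ _).trans ?_
      rw [Finset.mul_sum]
      refine Finset.sum_le_sum fun u hu => ?_
      rw [abs_mul, abs_mul, abs_two]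
      nlinarith [mul_le_mul_of_nonneg_left (hy u hu) (abs_nonneg (p t u))]
    rw [Real.norm_eq_abs, abs_mul, abs_mul, abs_neg, abs_of_pos (Real.exp_pos _),
      abs_of_pos (half_pos hlam)]
    calc _ ≤ Real.exp (-(lam / 2) * ∑ u ∈ S, p t u ^ 2) *
          (lam / 2 * (2 * a * ∑ u ∈ S, |p t u|)) := by gcongr
      _ = (lam * (∑ u ∈ S, |p t u|) * Real.exp (-(lam / 2) * ∑ u ∈ S, p t u ^ 2)) * a := by ring
      _ ≤ κ * a := by
        gcongr
        exact mul_sum_abs_mul_exp_le S (p t) hlam hκ hS hD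
  have := norm_image_sub_le_of_norm_deriv_le_segment_01'
    (fun t _ => (hg t).hasDerivWithinAt) hbound
  simpa [g, p] using this

lemma abs_exp_sub_exp_le {x y : ℝ} (hx : x ≤ 0) (hy : y ≤ 0) :
    |Real.exp x - Real.exp y| ≤ |x - y| := by
  wlog h : y ≤ x generalizing x y
  · rw [abs_sub_comm, abs_sub_comm x]
    exact this hy hx (le_of_not_ge h)
  have h1 := Real.add_one_le_exp (y - x)
  have h2 : Real.exp y = Real.exp x * Real.exp (y - x) := by rw [← Real.exp_add]; ring_nf
  have h3 := Real.exp_le_one_iff.2 hx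
  have h4 := Real.exp_pos x
  rw [abs_of_nonneg (sub_nonneg.2 (Real.exp_le_exp.2 h)), abs_of_nonneg (sub_nonneg.2 h), h2]
  nlinarith

lemma abs_log_one_add_sub_le {x : ℝ} (hx : 0 ≤ x) : |x - Real.log (1 + x)| ≤ x ^ 2 := by
  have h1 := Real.log_le_sub_one_of_pos (show 0 < 1 + x by linarith)
  have h2 := Real.one_sub_inv_le_log_of_pos (show 0 < 1 + x by linarith)
  have h3 : x - x ^ 2 ≤ 1 - (1 + x)⁻¹ := by
    have : 1 - (1 + x)⁻¹ - (x - x ^ 2) = x ^ 3 / (1 + x) := by field_simp; ring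
    have : 0 ≤ x ^ 3 / (1 + x) := by positivity
    linarith
  rw [abs_of_nonneg (by linarith)]
  linarith

end Contraction

section Probability

variable {V : Type} [Fintype V] [DecidableEq V] (G : SimpleGraph V) {lam : ℝ}

lemma gibbs_nonneg (hlam : 0 < lam) (σ : Finset V) : 0 ≤ gibbs G lam σ :=
  div_nonneg (weight_nonneg G hlam σ) (Finset.sum_nonneg fun _ _ => weight_nonneg G hlam _)

lemma gibbsProb_le_gibbsSum_div (hlam : 0 < lam) {A : Set (Finset V)} {f : Finset V → ℝ}
    (hf : ∀ σ, 0 ≤ f σ) (hA : ∀ σ ∈ A, 1 ≤ f σ) :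
    gibbsProb G lam A ≤ gibbsSum G lam f / gibbsSum G lam (fun _ => 1) := by
  rw [gibbsProb, gibbsSum, Finset.sum_div]
  refine Finset.sum_le_sum fun σ _ => ?_
  have h : weight G lam σ * f σ / gibbsSum G lam (fun _ => 1) = gibbs G lam σ * f σ := by
    simp only [gibbs, gibbsSum, mul_one]; ring
  rw [h]
  have h0 := gibbs_nonneg G hlam σ
  split_ifs with hσ
  · exact le_mul_of_one_le_right h0 (hA σ hσ)
  · exact mul_nonneg h0 (hf σ)

lemma gibbsProb_add_compl (hlam : 0 < lam) (A : Set (Finset V)) :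
    gibbsProb G lam A + gibbsProb G lam Aᶜ = 1 := by
  have h1 : ∑ σ : Finset V, gibbs G lam σ = 1 := by
    simp only [gibbs]
    rw [← Finset.sum_div]
    refine div_self ?_
    have := gibbsSum_one_pos G hlam
    simp only [gibbsSum, mul_one] at this
    exact this.ne'
  rw [gibbsProb, gibbsProb, ← Finset.sum_add_distrib, ← h1]
  refine Finset.sum_congr rfl fun σ _ => ?_
  by_cases h : σ ∈ A <;> simp [h]

lemma gibbsProb_le_add_sum {ι : Type*} (hlam : 0 < lam) {A B : Set (Finset V)} (S : Finset ι)
    (E : ι → Set (Finset V)) (h : ∀ σ ∈ A, σ ∈ B ∨ ∃ u ∈ S, σ ∈ E u) :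
    gibbsProb G lam A ≤ gibbsProb G lam B + ∑ u ∈ S, gibbsProb G lam (E u) := by
  simp only [gibbsProb]
  rw [Finset.sum_comm, ← Finset.sum_add_distrib]
  refine Finset.sum_le_sum fun σ _ => ?_
  have h0 := gibbs_nonneg G hlam σ
  have hB : 0 ≤ if σ ∈ B then gibbs G lam σ else 0 := by split_ifs; exacts [h0, le_rfl]
  have hE : ∀ u ∈ S, 0 ≤ if σ ∈ E u then gibbs G lam σ else 0 := fun u _ => by
    split_ifs; exacts [h0, le_rfl]
  by_cases hA : σ ∈ A
  · rw [if_pos hA]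
    rcases h σ hA with hb | ⟨u, hu, hσ⟩
    · rw [if_pos hb]
      linarith [Finset.sum_nonneg hE]
    · have := Finset.single_le_sum hE hu
      rw [if_pos hσ] at this
      linarith
  · rw [if_neg hA]
    exact add_nonneg hB (Finset.sum_nonneg hE)

variable [DecidableRel G.Adj]

lemma gibbsSum_mul_exp_le (hlam : 0 < lam) {v z : V}
    (htri : ∀ w w', G.Adj z w → G.Adj z w' → ¬ G.Adj w w') {K : Finset V → ℝ}
    (hK0 : ∀ σ, 0 ≤ K σ) (hKz : FreeAt K z) (hK : ∀ w, G.Adj z w → w ≠ v → FreeAt K w)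
    {s : ℝ} (hs : |s| ≤ 1) :
    gibbsSum G lam
        (fun σ => K σ * Real.exp (s * (unblockedInd G σ z v - Rerase G lam v z σ))) ≤
      (1 + |s| * lam + s ^ 2) * gibbsSum G lam K := by
  have h1 := abs_gibbsSum_unblockedInd_sub_le G hlam htri hK0 hKz hK
  set X : Finset V → ℝ := fun σ => unblockedInd G σ z v - Rerase G lam v z σ with hX
  have hX1 : ∀ σ, |X σ| ≤ 1 := fun σ => by
    have hU := unblockedInd_mem G σ z v
    have hR := Rerase_mem G hlam v z σ
    simp only [hX, abs_le]; constructor <;> linarith [hU.1, hU.2, hR.1, hR.2]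
  have h2 : gibbsSum G lam (fun σ => K σ * Real.exp (s * X σ)) ≤
      gibbsSum G lam (fun σ => (1 + s ^ 2) * K σ + s * (K σ * X σ)) := by
    refine gibbsSum_mono G hlam fun σ => ?_
    have hsX : |s * X σ| ≤ |s| := by
      rw [abs_mul]; exact mul_le_of_le_one_right (abs_nonneg s) (hX1 σ)
    have h3 := le_of_abs_le (Real.abs_exp_sub_one_sub_id_le (hsX.trans hs))
    have h4 : (s * X σ) ^ 2 ≤ s ^ 2 := sq_le_sq.2 hsX
    have h5 : Real.exp (s * X σ) ≤ 1 + s ^ 2 + s * X σ := by linarith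
    calc _ ≤ K σ * (1 + s ^ 2 + s * X σ) := mul_le_mul_of_nonneg_left h5 (hK0 σ)
      _ = _ := by ring
  rw [gibbsSum_add, gibbsSum_const_mul, gibbsSum_const_mul] at h2
  have h6 : s * gibbsSum G lam (fun σ => K σ * X σ) ≤ |s| * (lam * gibbsSum G lam K) := by
    refine (le_abs_self _).trans ?_
    rw [abs_mul]
    exact mul_le_mul_of_nonneg_left h1 (abs_nonneg s)
  linarith

lemma gibbsSum_prod_exp_le (hg : 6 ≤ G.egirth) (hlam : 0 < lam) (v : V) {s : ℝ} (hs : |s| ≤ 1)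
    (A : Finset V) (hA : ∀ z ∈ A, G.Adj v z) :
    gibbsSum G lam
        (fun σ => ∏ z ∈ A, Real.exp (s * (unblockedInd G σ z v - Rerase G lam v z σ))) ≤
      (1 + |s| * lam + s ^ 2) ^ A.card * gibbsSum G lam (fun _ => 1) := by
  induction A using Finset.induction_on with
  | empty => simp
  | insert z A hz ih =>
    have hfree : ∀ w, (w = z ∨ (G.Adj z w ∧ w ≠ v)) → FreeAt
        (fun σ => ∏ z ∈ A, Real.exp (s * (unblockedInd G σ z v - Rerase G lam v z σ))) w := by
      intro w hw
      refine FreeAt.prod fun z' hz' => ?_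
      have hvz := hA z (by simp)
      have hvz' := hA z' (by simp [hz'])
      have hzz : z ≠ z' := by rintro rfl; exact hz hz'
      have hU : FreeAt (fun σ => unblockedInd G σ z' v) w := by
        refine freeAt_unblockedInd G (Or.inr fun h => ?_)
        rcases hw with rfl | ⟨hw, hwv⟩
        · exact not_adj_of_egirth hg hvz' hvz h
        · exact hwv (eq_of_adj_of_egirth hg hvz hvz' hzz hw h)
      have hR : FreeAt (Rerase G lam v z') w := by
        refine FreeAt.prod fun w' hw' => ?_
        simp only [Finset.mem_erase, SimpleGraph.mem_neighborFinset] at hw'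
        refine FreeAt.comp (freeAt_unblockedInd G (Or.inr fun h => ?_))
          (fun x => 1 - lam / (1 + lam) * x)
        rcases hw with rfl | ⟨hw, hwv⟩
        · exact hw'.1 (eq_of_adj_of_egirth hg hvz hvz' hzz h.symm hw'.2)
        · exact not_adj_of_adj_of_egirth hg hvz hvz' hzz hw hw'.2 hwv hw'.1 h.symm
      intro σ
      simp only [hU σ, hR σ]
    have h1 := gibbsSum_mul_exp_le G hlam (v := v) (z := z)
      (fun w w' h h' => not_adj_of_egirth hg h h')
      (K := fun σ => ∏ z ∈ A, Real.exp (s * (unblockedInd G σ z v - Rerase G lam v z σ)))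
      (fun σ => Finset.prod_nonneg fun _ _ => (Real.exp_pos _).le) (hfree z (Or.inl rfl))
      (fun w h h' => hfree w (Or.inr ⟨h, h'⟩)) hs
    have hc : 0 ≤ 1 + |s| * lam + s ^ 2 := by positivity
    have h2 := mul_le_mul_of_nonneg_left (ih fun a ha => hA a (by simp [ha])) hc
    simp only [Finset.prod_insert hz, Finset.card_insert_of_notMem hz]
    calc _ = _ := by congr 1; funext σ; rw [mul_comm]
      _ ≤ _ := h1
      _ ≤ _ := h2
      _ = _ := by ring

/-- Chernoff bound for the number of unblocked neighbours of `v`. -/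
lemma gibbsProb_abs_sum_gt_le (hg : 6 ≤ G.egirth) (hlam : 0 < lam) (v : V) {D s t : ℝ}
    (hD : ((G.neighborFinset v).card : ℝ) ≤ D) (hs0 : 0 ≤ s) (hs : s ≤ 1) :
    gibbsProb G lam
        {σ | t < |∑ z ∈ G.neighborFinset v, (unblockedInd G σ z v - Rerase G lam v z σ)|} ≤
      2 * Real.exp (-(s * t) + D * (s * lam + s ^ 2)) := by
  set N := G.neighborFinset v
  set X : V → Finset V → ℝ := fun z σ => unblockedInd G σ z v - Rerase G lam v z σ
  have hZ := gibbsSum_one_pos G hlam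
  have hN : ∀ z ∈ N, G.Adj v z := fun z hz => by simpa [N] using hz
  have hmgf : ∀ r : ℝ, |r| = s →
      gibbsSum G lam (fun σ => ∏ z ∈ N, Real.exp (r * X z σ)) ≤
        Real.exp (D * (s * lam + s ^ 2)) * gibbsSum G lam (fun _ => 1) := fun r hr => by
    refine (gibbsSum_prod_exp_le G hg hlam v (hr.trans_le hs) N hN).trans ?_
    refine mul_le_mul_of_nonneg_right ?_ hZ.le
    rw [← sq_abs r, hr]
    have h0 : 0 ≤ s * lam + s ^ 2 := by positivity
    calc (1 + s * lam + s ^ 2) ^ N.card ≤ Real.exp (s * lam + s ^ 2) ^ N.card := by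
          refine pow_le_pow_left₀ (by positivity) ?_ _
          linarith [Real.add_one_le_exp (s * lam + s ^ 2)]
      _ = Real.exp (N.card * (s * lam + s ^ 2)) := by rw [← Real.exp_nat_mul]
      _ ≤ _ := Real.exp_le_exp.2 (mul_le_mul_of_nonneg_right hD h0)
  have hprod : ∀ r σ, ∏ z ∈ N, Real.exp (r * X z σ) = Real.exp (r * ∑ z ∈ N, X z σ) :=
    fun r σ => by rw [Finset.mul_sum, Real.exp_sum]
  refine (gibbsProb_le_gibbsSum_div G hlam
    (f := fun σ => Real.exp (-(s * t)) * (∏ z ∈ N, Real.exp (s * X z σ) +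
      ∏ z ∈ N, Real.exp (-s * X z σ))) (fun σ => by positivity) fun σ hσ => ?_).trans ?_
  · rw [hprod, hprod, mul_add, ← Real.exp_add, ← Real.exp_add]
    have hσ' : t < |∑ z ∈ N, X z σ| := hσ
    rcases lt_abs.1 hσ' with h | h
    · have : 1 ≤ Real.exp (-(s * t) + s * ∑ z ∈ N, X z σ) := Real.one_le_exp (by nlinarith)
      linarith [Real.exp_pos (-(s * t) + -s * ∑ z ∈ N, X z σ)]
    · have : 1 ≤ Real.exp (-(s * t) + -s * ∑ z ∈ N, X z σ) := Real.one_le_exp (by nlinarith)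
      linarith [Real.exp_pos (-(s * t) + s * ∑ z ∈ N, X z σ)]
  · rw [div_le_iff₀ hZ, gibbsSum_const_mul, gibbsSum_add, Real.exp_add]
    have h1 := hmgf s (abs_of_nonneg hs0)
    have h2 := hmgf (-s) (by rw [abs_neg, abs_of_nonneg hs0])
    have := mul_le_mul_of_nonneg_left (add_le_add h1 h2) (Real.exp_pos (-(s * t))).le
    linarith

end Probability

section Recurrence

variable {V : Type} [Fintype V] [DecidableEq V] (G : SimpleGraph V) [DecidableRel G.Adj]
  {lam : ℝ}

lemma Rfun_eq_exp (hlam : 0 < lam) (σ : Finset V) (v : V) :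
    Rfun G lam σ v =
      Real.exp (-(Real.log (1 + lam) * ∑ z ∈ G.neighborFinset v, unblockedInd G σ z v)) := by
  rw [Rfun, Finset.mul_sum, ← Finset.sum_neg_distrib, Real.exp_sum]
  refine Finset.prod_congr rfl fun z _ => ?_
  have h : 0 < 1 + lam := by linarith
  unfold unblockedInd
  split_ifs
  · rw [mul_one, mul_one, Real.exp_neg, Real.exp_log h]
    field_simp
    ring
  · simp

lemma Rfun_mem (hlam : 0 < lam) (σ : Finset V) (v : V) :
    Rfun G lam σ v ∈ Set.Icc (0 : ℝ) 1 :=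
  ⟨Finset.prod_nonneg fun w _ => (factor_mem G hlam σ w v).1,
    Finset.prod_le_one (fun w _ => (factor_mem G hlam σ w v).1)
      fun w _ => (factor_mem G hlam σ w v).2⟩

lemma abs_sqrt_Rfun_sub_exp_le (hlam : 0 < lam) (σ : Finset V) (v : V) {D t : ℝ}
    (hD : ((G.neighborFinset v).card : ℝ) ≤ D)
    (ht : |∑ z ∈ G.neighborFinset v, (unblockedInd G σ z v - Rerase G lam v z σ)| ≤ t) :
    |√(Rfun G lam σ v) - Real.exp (-(lam / 2) * ∑ z ∈ G.neighborFinset v, Rfun G lam σ z)| ≤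
      lam ^ 2 * D + lam * t / 2 := by
  set N := G.neighborFinset v
  set T := ∑ z ∈ N, unblockedInd G σ z v
  set Q := ∑ z ∈ N, Rfun G lam σ z
  have hT0 : 0 ≤ T := Finset.sum_nonneg fun z _ => (unblockedInd_mem G σ z v).1
  have hTD : T ≤ D := by
    refine le_trans ?_ hD
    simpa using Finset.sum_le_card_nsmul N _ 1 fun z _ => (unblockedInd_mem G σ z v).2
  have hQ0 : 0 ≤ Q := Finset.sum_nonneg fun z _ => (Rfun_mem G hlam σ z).1
  have hTQ : |T - Q| ≤ t + lam * D := by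
    have e : T - Q = ∑ z ∈ N, (unblockedInd G σ z v - Rerase G lam v z σ) -
        ∑ z ∈ N, (Rfun G lam σ z - Rerase G lam v z σ) := by
      simp only [Finset.sum_sub_distrib, T, Q]; ring
    have h2 : |∑ z ∈ N, (Rfun G lam σ z - Rerase G lam v z σ)| ≤ lam * D := by
      refine (Finset.abs_sum_le_sum_abs _ _).trans ?_
      refine (Finset.sum_le_card_nsmul N _ lam fun z hz =>
        abs_Rfun_sub_Rerase_le G hlam (by simpa [N] using hz) σ).trans ?_
      rw [nsmul_eq_mul, mul_comm]
      exact mul_le_mul_of_nonneg_left hD hlam.le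
    rw [e]
    exact (abs_sub _ _).trans (add_le_add ht h2)
  have hlog : 0 ≤ Real.log (1 + lam) := Real.log_nonneg (by linarith)
  rw [Rfun_eq_exp G hlam, ← Real.exp_half]
  refine (abs_exp_sub_exp_le (by nlinarith [mul_nonneg hlog hT0])
    (by nlinarith [mul_nonneg hlam.le hQ0])).trans ?_
  have e : -(Real.log (1 + lam) * T) / 2 - -(lam / 2) * Q =
      (lam - Real.log (1 + lam)) * T / 2 - lam * (T - Q) / 2 := by ring
  rw [e]
  have h1 : |(lam - Real.log (1 + lam)) * T / 2| ≤ lam ^ 2 * D / 2 := by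
    rw [abs_div, abs_mul, abs_of_nonneg hT0, abs_two]
    gcongr
    exact abs_log_one_add_sub_le hlam.le
  have h2 : |lam * (T - Q) / 2| ≤ lam * (t + lam * D) / 2 := by
    rw [abs_div, abs_mul, abs_of_pos hlam, abs_two]
    gcongr
  refine (abs_sub _ _).trans ((add_le_add h1 h2).trans (le_of_eq (by ring)))

lemma abs_sqrt_sub_exp_le_of_bpF_eq (hlam : 0 < lam) {ω : V → ℝ}
    (hω : ∀ u, ω u ∈ Set.Icc (0 : ℝ) 1) (hfix : bpF G lam ω = ω) (v : V) {D : ℝ}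
    (hD : ((G.neighborFinset v).card : ℝ) ≤ D) :
    |√(ω v) - Real.exp (-(lam / 2) * ∑ z ∈ G.neighborFinset v, ω z)| ≤ lam ^ 2 * D / 2 := by
  set N := G.neighborFinset v
  have h0 : ∀ u, 0 ≤ lam * ω u := fun u => mul_nonneg hlam.le (hω u).1
  have hexp : ω v = Real.exp (-∑ z ∈ N, Real.log (1 + lam * ω z)) := by
    conv_lhs => rw [← hfix]
    rw [bpF, ← Finset.sum_neg_distrib, Real.exp_sum]
    refine Finset.prod_congr rfl fun z _ => ?_
    rw [Real.exp_neg, Real.exp_log (by linarith [h0 z])]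
  have hlog : 0 ≤ ∑ z ∈ N, Real.log (1 + lam * ω z) :=
    Finset.sum_nonneg fun z _ => Real.log_nonneg (by linarith [h0 z])
  have hQ0 : 0 ≤ ∑ z ∈ N, ω z := Finset.sum_nonneg fun z _ => (hω z).1
  rw [hexp, ← Real.exp_half]
  refine (abs_exp_sub_exp_le (by linarith) (by nlinarith [mul_nonneg hlam.le hQ0])).trans ?_
  have e : -(∑ z ∈ N, Real.log (1 + lam * ω z)) / 2 - -(lam / 2) * ∑ z ∈ N, ω z =
      (∑ z ∈ N, (lam * ω z - Real.log (1 + lam * ω z))) / 2 := by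
    rw [Finset.sum_sub_distrib, ← Finset.mul_sum]; ring
  rw [e, abs_div, abs_two]
  gcongr
  refine (Finset.abs_sum_le_sum_abs _ _).trans ?_
  refine (Finset.sum_le_card_nsmul N _ (lam ^ 2) fun z _ => ?_).trans ?_
  · refine (abs_log_one_add_sub_le (h0 z)).trans ?_
    exact pow_le_pow_left₀ (h0 z) (mul_le_of_le_one_right hlam.le (hω z).2) 2
  · rw [nsmul_eq_mul, mul_comm]
    exact mul_le_mul_of_nonneg_left hD (by positivity)

lemma abs_sqrt_Rfun_sub_sqrt_le (hlam : 0 < lam) {ω : V → ℝ}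
    (hω : ∀ u, ω u ∈ Set.Icc (0 : ℝ) 1) (hfix : bpF G lam ω = ω) (v : V) (σ : Finset V)
    {D t κ a : ℝ} (hD : ((G.neighborFinset v).card : ℝ) ≤ D) (hκ : 0 ≤ κ) (ha : 0 ≤ a)
    (hlamD : lam * D ≤ κ ^ 2 * Real.exp 1)
    (ht : |∑ z ∈ G.neighborFinset v, (unblockedInd G σ z v - Rerase G lam v z σ)| ≤ t)
    (hnb : ∀ u ∈ G.neighborFinset v, |√(Rfun G lam σ u) - √(ω u)| ≤ a) :
    |√(Rfun G lam σ v) - √(ω v)| ≤ κ * a + (3 / 2 * lam ^ 2 * D + lam * t / 2) := by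
  have h1 := abs_sqrt_Rfun_sub_exp_le G hlam σ v hD ht
  have h2 := abs_sqrt_sub_exp_le_of_bpF_eq G hlam hω hfix v hD
  have h3 := abs_exp_neg_sum_sq_sub_le (G.neighborFinset v) (fun u => √(ω u))
    (fun u => √(Rfun G lam σ u)) hlam hκ ha hD hlamD hnb
  simp only [Real.sq_sqrt (hω _).1, Real.sq_sqrt (Rfun_mem G hlam σ _).1] at h3
  rw [abs_le] at *
  constructor <;> linarith [h1.1, h1.2, h2.1, h2.2, h3.1, h3.2]

lemma gibbsProb_abs_sqrt_Rfun_sub_gt_le (hlam : 0 < lam) {ω : V → ℝ}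
    (hω : ∀ u, ω u ∈ Set.Icc (0 : ℝ) 1) (hfix : bpF G lam ω = ω) {D t κ ε q : ℝ}
    (hD : ∀ v, ((G.neighborFinset v).card : ℝ) ≤ D) (hD0 : 0 ≤ D) (hκ : 0 ≤ κ) (hκ1 : κ < 1)
    (hlamD : lam * D ≤ κ ^ 2 * Real.exp 1) (hε0 : 0 ≤ ε)
    (hε : 3 / 2 * lam ^ 2 * D + lam * t / 2 ≤ ε) (hq0 : 0 ≤ q)
    (hq : ∀ v, gibbsProb G lam
      {σ | t < |∑ z ∈ G.neighborFinset v, (unblockedInd G σ z v - Rerase G lam v z σ)|} ≤ q)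
    (L : ℕ) (v : V) :
    gibbsProb G lam {σ | κ ^ L + ε / (1 - κ) < |√(Rfun G lam σ v) - √(ω v)|} ≤
      q * (D + 1) ^ L := by
  have hκ' : 0 < 1 - κ := by linarith
  have hεκ : 0 ≤ ε / (1 - κ) := by positivity
  induction L generalizing v with
  | zero =>
    have : {σ | κ ^ 0 + ε / (1 - κ) < |√(Rfun G lam σ v) - √(ω v)|} = ∅ := by
      refine Set.eq_empty_of_forall_notMem fun σ hσ => ?_
      have h1 := Real.sqrt_le_one.2 (Rfun_mem G hlam σ v).2
      have h2 := Real.sqrt_le_one.2 (hω v).2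
      have h3 := Real.sqrt_nonneg (Rfun G lam σ v)
      have h4 := Real.sqrt_nonneg (ω v)
      have h5 : |√(Rfun G lam σ v) - √(ω v)| ≤ 1 := by
        rw [abs_le]; constructor <;> linarith
      simp only [Set.mem_ofPred_eq, pow_zero] at hσ
      linarith
    rw [this]
    simpa [gibbsProb] using hq0
  | succ L ih =>
    refine (gibbsProb_le_add_sum G hlam (G.neighborFinset v)
      (fun u => {σ | κ ^ L + ε / (1 - κ) < |√(Rfun G lam σ u) - √(ω u)|})
      (B := {σ | t < |∑ z ∈ G.neighborFinset v,
        (unblockedInd G σ z v - Rerase G lam v z σ)|}) fun σ hσ => ?_).trans ?_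
    · by_contra! hcon
      simp only [Set.mem_ofPred_eq, not_lt] at hσ hcon
      have h := abs_sqrt_Rfun_sub_sqrt_le G hlam hω hfix v σ (hD v) hκ (by positivity) hlamD
        hcon.1 hcon.2
      have e : κ * (κ ^ L + ε / (1 - κ)) + ε = κ ^ (L + 1) + ε / (1 - κ) := by
        field_simp; ring
      linarith
    · have h1 : ∑ u ∈ G.neighborFinset v,
          gibbsProb G lam {σ | κ ^ L + ε / (1 - κ) < |√(Rfun G lam σ u) - √(ω u)|} ≤
          D * (q * (D + 1) ^ L) := by
        refine (Finset.sum_le_card_nsmul _ _ _ fun u _ => ih u).trans ?_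
        rw [nsmul_eq_mul]
        exact mul_le_mul_of_nonneg_right (hD v) (by positivity)
      have h2 : q ≤ q * (D + 1) ^ L := le_mul_of_one_le_right hq0 (one_le_pow₀ (by linarith))
      calc _ ≤ q + D * (q * (D + 1) ^ L) := add_le_add (hq v) h1
        _ ≤ q * (D + 1) ^ L + D * (q * (D + 1) ^ L) := by linarith
        _ = _ := by ring

lemma abs_sub_le_two_mul_abs_sqrt_sub {x y : ℝ} (hx : x ∈ Set.Icc (0 : ℝ) 1)
    (hy : y ∈ Set.Icc (0 : ℝ) 1) : |x - y| ≤ 2 * |√x - √y| := by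
  have h1 := Real.sqrt_le_one.2 hx.2
  have h2 := Real.sqrt_le_one.2 hy.2
  have h3 := Real.sqrt_nonneg x
  have h4 := Real.sqrt_nonneg y
  have e : x - y = (√x + √y) * (√x - √y) := by
    nlinarith [Real.sq_sqrt hx.1, Real.sq_sqrt hy.1]
  rw [e, abs_mul, abs_of_nonneg (by linarith)]
  exact mul_le_mul_of_nonneg_right (by linarith) (abs_nonneg _)

end Recurrence

section Asymptotics

lemma lambdaC_mul_le {D : ℕ} (hD : 3 ≤ D) :
    lambdaC D * D ≤ Real.exp 1 * (1 + 5 / ((D : ℝ) - 2)) := by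
  obtain ⟨n, rfl⟩ : ∃ n, D = n + 2 := ⟨D - 2, by omega⟩
  have hn : (1 : ℝ) ≤ n := by exact_mod_cast (by omega : 1 ≤ n)
  have hn0 : (0 : ℝ) < n := by linarith
  have h1 : ((n : ℝ) + 1) ^ n ≤ Real.exp 1 * (n : ℝ) ^ n := by
    have h2 : (n : ℝ) + 1 ≤ Real.exp (1 / n) * n := by
      have := mul_le_mul_of_nonneg_right (Real.add_one_le_exp (1 / (n : ℝ))) hn0.le
      have e : (1 / (n : ℝ) + 1) * n = n + 1 := by field_simp; ring
      linarith
    calc ((n : ℝ) + 1) ^ n ≤ (Real.exp (1 / n) * n) ^ n := by gcongr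
      _ = Real.exp 1 * (n : ℝ) ^ n := by
        rw [mul_pow, ← Real.exp_nat_mul]; congr 2; field_simp
  have e1 : ((n + 2 : ℕ) : ℝ) - 1 = n + 1 := by push_cast; ring
  have e2 : ((n + 2 : ℕ) : ℝ) - 2 = n := by push_cast; ring
  rw [lambdaC, e1, e2, show n + 2 - 1 = n + 1 from rfl, div_mul_eq_mul_div,
    div_le_iff₀ (by positivity)]
  have e3 : Real.exp 1 * (1 + 5 / (n : ℝ)) * (n : ℝ) ^ (n + 2) =
      Real.exp 1 * (n : ℝ) ^ n * (n ^ 2 + 5 * n) := by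
    field_simp
    ring
  rw [e3, pow_succ]
  push_cast
  calc ((n : ℝ) + 1) ^ n * (n + 1) * (n + 2) = ((n : ℝ) + 1) ^ n * ((n + 1) * (n + 2)) := by ring
    _ ≤ Real.exp 1 * (n : ℝ) ^ n * ((n + 1) * (n + 2)) := by gcongr
    _ ≤ _ := by
      refine mul_le_mul_of_nonneg_left (by nlinarith) (by positivity)

lemma eventually_mul_le_of_lt_lambdaC {δ : ℝ} (hδ : 0 < δ) (hδ1 : δ < 1) :
    ∀ᶠ D : ℕ in Filter.atTop, ∀ lam : ℝ, lam < (1 - δ) * lambdaC D →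
      lam * D ≤ (1 - δ / 2) * Real.exp 1 := by
  filter_upwards [Filter.eventually_ge_atTop 3,
    tendsto_natCast_atTop_atTop.eventually_ge_atTop (10 / δ + 2)] with D hD3 hD lam hlam
  have hpos : (0 : ℝ) < (D : ℝ) - 2 := by
    have : 0 < 10 / δ := by positivity
    linarith
  have h5 : 5 / ((D : ℝ) - 2) ≤ δ / 2 := by
    have : 10 / δ ≤ (D : ℝ) - 2 := by linarith
    rw [div_le_iff₀ hδ] at this
    rw [div_le_iff₀ hpos]
    linarith
  have he := Real.exp_pos 1
  calc lam * D ≤ (1 - δ) * lambdaC D * D := by gcongr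
    _ = (1 - δ) * (lambdaC D * D) := by ring
    _ ≤ (1 - δ) * (Real.exp 1 * (1 + 5 / ((D : ℝ) - 2))) :=
      mul_le_mul_of_nonneg_left (lambdaC_mul_le hD3) (by linarith)
    _ ≤ (1 - δ) * (Real.exp 1 * (1 + δ / 2)) := by
      refine mul_le_mul_of_nonneg_left ?_ (by linarith)
      gcongr
    _ ≤ (1 - δ / 2) * Real.exp 1 := by nlinarith [mul_pos he hδ, mul_pos (mul_pos he hδ) hδ]

lemma eventually_pow_mul_exp_le {b M : ℝ} (hb : 0 < b) (hM : 0 < M) (L : ℕ) :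
    ∀ᶠ D : ℕ in Filter.atTop, M * ((D : ℝ) + 1) ^ L ≤ Real.exp (b * D) := by
  have h := (isLittleO_pow_exp_pos_mul_atTop (k := L) hb).bound
    (show 0 < (M * Real.exp b)⁻¹ by positivity)
  have ht : Filter.Tendsto (fun D : ℕ => (D : ℝ) + 1) Filter.atTop Filter.atTop :=
    Filter.tendsto_atTop_add_const_right _ _ tendsto_natCast_atTop_atTop
  filter_upwards [ht.eventually h] with D hD
  rw [Real.norm_of_nonneg (by positivity), Real.norm_of_nonneg (Real.exp_pos _).le,
    mul_add, mul_one, Real.exp_add] at hD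
  calc M * ((D : ℝ) + 1) ^ L
      ≤ M * ((M * Real.exp b)⁻¹ * (Real.exp (b * D) * Real.exp b)) := by gcongr
    _ = Real.exp (b * D) := by field_simp

end Asymptotics

end HardCore

theorem R_concentrates_at_bp_fixed_point :
    ∀ δ θ : ℝ, 0 < δ → 0 < θ →
    ∃ (Δ₀ : ℕ) (C : ℝ), 0 < C ∧
      ∀ (V : Type) [Fintype V] [DecidableEq V] (G : SimpleGraph V) [DecidableRel G.Adj]
        (Δ : ℕ) (lam : ℝ),
        G.maxDegree = Δ → Δ₀ ≤ Δ → 6 ≤ G.egirth →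
        0 < lam → lam < (1 - δ) * lambdaC Δ →
        ∀ ωstar : V → ℝ, (∀ u : V, ωstar u ∈ Set.Icc (0 : ℝ) 1) →
          bpF G lam ωstar = ωstar →
        ∀ z : V,
          gibbsProb G lam {σ : Finset V | |Rfun G lam σ z - ωstar z| ≤ θ}
            ≥ 1 - Real.exp (-(Δ : ℝ) / C) := by
  intro δ θ hδ hθ
  rcases le_or_gt 1 δ with hδ1 | hδ1
  · refine ⟨2, 1, one_pos, ?_⟩
    intro V _ _ G _ Δ lam _ hΔ _ hlam hlt
    exfalso
    have h2 : (2 : ℝ) ≤ Δ := by exact_mod_cast hΔ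
    have hpos : 0 ≤ lambdaC Δ :=
      div_nonneg (pow_nonneg (by linarith) _) (pow_nonneg (by linarith) _)
    nlinarith
  set κ := √(1 - δ / 2) with hκdef
  have hκ0 : 0 ≤ κ := Real.sqrt_nonneg _
  have hκsq : κ ^ 2 = 1 - δ / 2 := Real.sq_sqrt (by linarith)
  have hκ1 : κ < 1 := by nlinarith
  have hκ' : 0 < 1 - κ := by linarith
  obtain ⟨L, hL⟩ := exists_pow_lt_of_lt_one (show 0 < θ / 4 by positivity) hκ1
  set η := min 1 (θ * (1 - κ) / 8)
  have hη : 0 < η := lt_min one_pos (by positivity)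
  have hη1 : η ≤ 1 := min_le_left _ _
  have hηθ : η ≤ θ * (1 - κ) / 8 := min_le_right _ _
  have hb : 0 < η ^ 2 / 8 := by positivity
  obtain ⟨Δ₀, hΔ₀⟩ := Filter.eventually_atTop.1
    ((eventually_mul_le_of_lt_lambdaC hδ hδ1).and
      ((eventually_pow_mul_exp_le hb (show 0 < 2 * Real.exp (3 / 2) by positivity) L).and
        (tendsto_natCast_atTop_atTop.eventually_ge_atTop (27 / η))))
  refine ⟨Δ₀, 8 / η ^ 2, by positivity, ?_⟩
  intro V _ _ G _ Δ lam hdeg hΔ hg hlam hlt ω hω hfix z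
  obtain ⟨hlamD, hpow, hΔη⟩ := hΔ₀ Δ hΔ
  replace hlamD : lam * Δ ≤ κ ^ 2 * Real.exp 1 := hκsq ▸ hlamD lam hlt
  have hD : ∀ v, ((G.neighborFinset v).card : ℝ) ≤ Δ := fun v => by
    rw [G.card_neighborFinset_eq_degree]
    exact_mod_cast hdeg ▸ G.degree_le_maxDegree v
  have hΔpos : (0 : ℝ) < Δ := lt_of_lt_of_le (by positivity) hΔη
  have hlam3 : lam * Δ ≤ 3 := by
    have := Real.exp_one_lt_three
    nlinarith [Real.exp_pos 1]
  have hlamη : lam ≤ η / 9 := by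
    rw [div_le_iff₀ hη] at hΔη
    nlinarith
  have hq := fun v => gibbsProb_abs_sum_gt_le G hg hlam v (t := η * Δ) (hD v)
    (half_pos hη).le (by linarith : η / 2 ≤ 1)
  have hmain := gibbsProb_abs_sqrt_Rfun_sub_gt_le G hlam hω hfix hD hΔpos.le hκ0 hκ1 hlamD
    (ε := 2 * η) (by positivity) (by nlinarith [mul_nonneg hlam.le hΔpos.le])
    (by positivity) hq L z
  have hbad : gibbsProb G lam {σ : Finset V | |Rfun G lam σ z - ω z| ≤ θ}ᶜ ≤
      gibbsProb G lam {σ | κ ^ L + 2 * η / (1 - κ) < |√(Rfun G lam σ z) - √(ω z)|} := by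
    have := gibbsProb_le_add_sum G hlam (A := {σ : Finset V | |Rfun G lam σ z - ω z| ≤ θ}ᶜ)
      (B := {σ | κ ^ L + 2 * η / (1 - κ) < |√(Rfun G lam σ z) - √(ω z)|})
      (∅ : Finset V) (fun _ => ∅) fun σ hσ => Or.inl ?_
    · simpa using this
    · have h1 : θ < |Rfun G lam σ z - ω z| := by simpa using hσ
      have h2 := abs_sub_le_two_mul_abs_sqrt_sub (Rfun_mem G hlam σ z) (hω z)
      have h3 : 2 * η / (1 - κ) ≤ θ / 4 := by
        rw [div_le_iff₀ hκ']; linarith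
      simp only [Set.mem_ofPred_eq]
      linarith
  have hexp : 2 * Real.exp (-(η / 2 * (η * Δ)) + Δ * (η / 2 * lam + (η / 2) ^ 2)) *
      ((Δ : ℝ) + 1) ^ L ≤ Real.exp (-(Δ : ℝ) / (8 / η ^ 2)) := by
    have h1 : -(η / 2 * (η * Δ)) + Δ * (η / 2 * lam + (η / 2) ^ 2) ≤
        3 / 2 + -(η ^ 2 / 4 * Δ) := by
      have : η * (lam * Δ) ≤ 3 := by nlinarith [mul_nonneg hlam.le hΔpos.le]
      nlinarith
    calc _ ≤ 2 * Real.exp (3 / 2 + -(η ^ 2 / 4 * Δ)) * ((Δ : ℝ) + 1) ^ L := by gcongr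
      _ = (2 * Real.exp (3 / 2) * ((Δ : ℝ) + 1) ^ L) * Real.exp (-(η ^ 2 / 4 * Δ)) := by
        rw [Real.exp_add]; ring
      _ ≤ Real.exp (η ^ 2 / 8 * Δ) * Real.exp (-(η ^ 2 / 4 * Δ)) := by gcongr
      _ = Real.exp (-(Δ : ℝ) / (8 / η ^ 2)) := by
        rw [← Real.exp_add]; congr 1; field_simp; ring
  have := gibbsProb_add_compl G hlam {σ : Finset V | |Rfun G lam σ z - ω z| ≤ θ}
  linarith
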